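/- Assume r ∈ [0,1] is fixed, α is strictly increasing on (a,b), β ∈ BV_loc((a,b),ℝ), and θ_{1−r}(x) ≠ 0 and θ_r(x) ≠ 0 for all x ∈ (a,b). If u is a nontrivial real-valued r-balanced solution of −d(dy/dα) + y dβ = 0 on (a,b), then Z_{(a,b)}(u) is a set of isolated points. -/

import Mathlib

open Set Filter Function MeasureTheory Topology

noncomputable section

/-- The open interval `(a,b) ⊆ ℝ` determined by extended-real endpoints `a`, `b`. -/
def EI (a b : EReal) : Set ℝ := {x : ℝ | a < (x : EReal) ∧ (x : EReal) < b}

/-- The jump `Δ_{df}(x) = f⁺(x) - f⁻(x)` of a real-valued function. -/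
def jump (f : ℝ → ℝ) (x : ℝ) : ℝ := rightLim f x - leftLim f x

/-- The jump `Δ_{df}(x) = f⁺(x) - f⁻(x)` of a complex-valued function. -/
def jumpC (f : ℝ → ℂ) (x : ℝ) : ℂ := rightLim f x - leftLim f x

/-- `θ_z(x) = 1 - z² Δ_{dα}(x) Δ_{dβ}(x)`. -/
def theta (α β : ℝ → ℝ) (z x : ℝ) : ℝ := 1 - z ^ 2 * jump α x * jump β x

/-- `ω(x) = 1 - Δ_{dα}(x) Δ_{dβ}(x) / 4`. -/
def omegaFn (α β : ℝ → ℝ) (x : ℝ) : ℝ := 1 - jump α x * jump β x / 4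

/-- A real-valued function is `r`-balanced on `I`: it is of locally bounded variation and
`f(x) = r f⁻(x) + (1-r) f⁺(x)` for all `x ∈ I`. -/
def RBalanced (r : ℝ) (I : Set ℝ) (f : ℝ → ℝ) : Prop :=
  LocallyBoundedVariationOn f I ∧
    ∀ x ∈ I, f x = r * leftLim f x + (1 - r) * rightLim f x

/-- A complex-valued function is `r`-balanced on `I`. -/
def RBalancedC (r : ℂ) (I : Set ℝ) (f : ℝ → ℂ) : Prop :=
  LocallyBoundedVariationOn f I ∧
    ∀ x ∈ I, f x = r * leftLim f x + (1 - r) * rightLim f x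

/-- `ν` coincides on `[c,d]` with the Lebesgue–Stieltjes measure `df` generated by `f`,
determined by `df((x,y]) = f⁺(y) - f⁺(x)`. -/
def SMRepresents (ν : SignedMeasure ℝ) (f : ℝ → ℝ) (c d : ℝ) : Prop :=
  ∀ x ∈ Icc c d, ∀ y ∈ Icc c d, x ≤ y → ν (Ioc x y) = rightLim f y - rightLim f x

/-- The integral of `h` against the signed measure `ν` over the set `E`. -/
def sInt (ν : SignedMeasure ℝ) (h : ℝ → ℝ) (E : Set ℝ) : ℝ :=
  (∫ x in E, h x ∂ν.toJordanDecomposition.posPart) -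
    (∫ x in E, h x ∂ν.toJordanDecomposition.negPart)

/-- The equality of (locally finite, real Borel) measures `dg = ∑ j, (h j) d(β j)` on the
interval `I`, expressed via localizations to compact subintervals of `I`. -/
def MeasureEqOn (I : Set ℝ) {ι : Type} [Fintype ι] (g : ℝ → ℝ) (h β : ι → ℝ → ℝ) : Prop :=
  ∀ c ∈ I, ∀ d ∈ I, c < d →
    ∃ (νg : SignedMeasure ℝ) (ν : ι → SignedMeasure ℝ),
      SMRepresents νg g c d ∧ (∀ j, SMRepresents (ν j) (β j) c d) ∧
      ∀ E : Set ℝ, E ⊆ Ioc c d → MeasurableSet E → νg E = ∑ j, sInt (ν j) (h j) E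

/-- The equality of complex measures `dg = ∑ j, (h j) d(β j)` on `I`, encoded via real and
imaginary parts. -/
def MeasureEqOnC (I : Set ℝ) {ι : Type} [Fintype ι] (g : ℝ → ℂ) (h β : ι → ℝ → ℂ) : Prop :=
  MeasureEqOn I (fun x => (g x).re)
    (Sum.elim (fun j x => (h j x).re) (fun j x => -(h j x).im))
    (Sum.elim (fun j x => (β j x).re) (fun j x => (β j x).im)) ∧
  MeasureEqOn I (fun x => (g x).im)
    (Sum.elim (fun j x => (h j x).im) (fun j x => (h j x).re))
    (Sum.elim (fun j x => (β j x).re) (fun j x => (β j x).im))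

/-- The support of `dα` is all of `I`: no open subinterval of `I` is `dα`-null, i.e. on no
open subinterval of `I` do all one-sided limits of `α` coincide with a single constant. -/
def SuppFull (I : Set ℝ) (α : ℝ → ℂ) : Prop :=
  ∀ x ∈ I, ∀ ε > (0 : ℝ), Icc (x - ε) (x + ε) ⊆ I →
    ¬ (∀ p ∈ Ioo (x - ε) (x + ε), ∀ q ∈ Ioo (x - ε) (x + ε),
        rightLim α p = rightLim α q ∧ leftLim α p = rightLim α q)

/-- `u`, together with the representative `w` of `du/dα`, is an `r`-balanced solution of the
homogeneous equation `-d(du/dα) + u dβ = 0` on `I`: `u` and `w` are `r`-balanced,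
`du = w dα` (so `du ≪ dα` with `du/dα = w`), and `dw = u dβ`. -/
def IsHomSol (I : Set ℝ) (r : ℝ) (α β u w : ℝ → ℝ) : Prop :=
  RBalanced r I u ∧ RBalanced r I w ∧
  MeasureEqOn I u (fun _ : Fin 1 => w) (fun _ => α) ∧
  MeasureEqOn I w (fun _ : Fin 1 => u) (fun _ => β)

/-- `u`, together with the representative `w` of `du/dα`, is an `r`-balanced solution of
`-d(du/dα) + u dβ = dη` on `I` (complex-valued coefficients): `dw = u dβ - dη`. -/
def IsSolC (I : Set ℝ) (r : ℂ) (α β η u w : ℝ → ℂ) : Prop :=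
  RBalancedC r I u ∧ RBalancedC r I w ∧
  MeasureEqOnC I u (fun _ : Fin 1 => w) (fun _ => α) ∧
  MeasureEqOnC I w ![u, fun _ => (-1 : ℂ)] ![β, η]

/-- `y` solves the linear system `dy = dφ · y + dψ` on `I`, componentwise:
`d(y i) = ∑ j, (y j) d(φ i j) + dψ i`. -/
def IsSysSolC (I : Set ℝ) (n : ℕ) (φ : ℝ → Matrix (Fin n) (Fin n) ℂ)
    (ψ : ℝ → Fin n → ℂ) (y : ℝ → Fin n → ℂ) : Prop :=
  ∀ i : Fin n,
    MeasureEqOnC I (fun x => y x i)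
      (Sum.elim (fun j : Fin n => fun x => y x j) (fun _ : Unit => fun _ => (1 : ℂ)))
      (Sum.elim (fun j : Fin n => fun x => φ x i j) (fun _ : Unit => fun x => ψ x i))

/-- `Z_I(f) = {x ∈ I : f⁻(x) f⁺(x) ≤ 0}`, the set of sign-changing points of `f` in `I`. -/
def ZSet (f : ℝ → ℝ) (I : Set ℝ) : Set ℝ := {x ∈ I | leftLim f x * rightLim f x ≤ 0}

/-- `u` changes sign at `s ∈ I`. -/
def ChangesSignAt (I : Set ℝ) (u : ℝ → ℝ) (s : ℝ) : Prop :=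
  ∃ δ > (0 : ℝ), Ioo (s - δ) (s + δ) ⊆ I ∧
    (((∀ x ∈ Ioo (s - δ) s, leftLim u x < 0) ∧ ∀ x ∈ Ioo s (s + δ), 0 < rightLim u x) ∨
     ((∀ x ∈ Ioo (s - δ) s, 0 < leftLim u x) ∧ ∀ x ∈ Ioo s (s + δ), rightLim u x < 0))

/-- `u` changes sign in `J` (a subinterval of `I`). -/
def ChangesSignIn (I : Set ℝ) (u : ℝ → ℝ) (J : Set ℝ) : Prop :=
  ∃ s ∈ J, ChangesSignAt I u s

/-- `u` and `v` are linearly dependent on `I`. -/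
def LinDepOn (I : Set ℝ) (u v : ℝ → ℝ) : Prop :=
  ∃ c₁ c₂ : ℝ, ¬(c₁ = 0 ∧ c₂ = 0) ∧ ∀ x ∈ I, c₁ * u x + c₂ * v x = 0

/-- The Lebesgue–Stieltjes measure `dg` is nonnegative on (Borel subsets of) `S`, expressed by
nonnegativity on all subintervals of `S` of each of the four kinds. -/
def PosMeasureOn (g : ℝ → ℝ) (S : Set ℝ) : Prop :=
  (∀ x y : ℝ, x ≤ y → Icc x y ⊆ S → 0 ≤ rightLim g y - leftLim g x) ∧
  (∀ x y : ℝ, x ≤ y → Ico x y ⊆ S → 0 ≤ leftLim g y - leftLim g x) ∧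
  (∀ x y : ℝ, x ≤ y → Ioc x y ⊆ S → 0 ≤ rightLim g y - rightLim g x) ∧
  (∀ x y : ℝ, x < y → Ioo x y ⊆ S → 0 ≤ leftLim g y - rightLim g x)

section OneSidedLimits

variable {f : ℝ → ℝ} {x : ℝ}

lemma rightLim_mem_of_forall_mem {U C : Set ℝ} (hU : IsOpen U) (hC : IsClosed C)
    (h : ∀ y ∈ U, f y ∈ C) (hx : x ∈ U) : rightLim f x ∈ C :=
  hC.mem_of_mapClusterPt (mapClusterPt_rightLim f x)
    (mem_nhdsWithin_of_mem_nhds (mem_of_superset (hU.mem_nhds hx) h))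

lemma leftLim_mem_of_forall_mem {U C : Set ℝ} (hU : IsOpen U) (hC : IsClosed C)
    (h : ∀ y ∈ U, f y ∈ C) (hx : x ∈ U) : leftLim f x ∈ C :=
  hC.mem_of_mapClusterPt (mapClusterPt_leftLim f x)
    (mem_nhdsWithin_of_mem_nhds (mem_of_superset (hU.mem_nhds hx) h))

/-- One-sided limits inherit, near `x` on one side, the closed neighbourhoods of the limit. -/
lemma eventually_lims_mem_nhdsGT {L : ℝ} {V : Set ℝ} (h : Tendsto f (𝓝[>] x) (𝓝 L))
    (hV : V ∈ 𝓝 L) : ∀ᶠ y in 𝓝[>] x, f y ∈ V ∧ leftLim f y ∈ V ∧ rightLim f y ∈ V := by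
  obtain ⟨C, hC, hCc, hCV⟩ := exists_mem_nhds_isClosed_subset hV
  obtain ⟨d, hd, hsub⟩ := mem_nhdsGT_iff_exists_Ioo_subset.1 (h hC)
  filter_upwards [Ioo_mem_nhdsGT hd] with y hy
  exact ⟨hCV (hsub hy), hCV (leftLim_mem_of_forall_mem isOpen_Ioo hCc hsub hy),
    hCV (rightLim_mem_of_forall_mem isOpen_Ioo hCc hsub hy)⟩

lemma eventually_lims_mem_nhdsLT {L : ℝ} {V : Set ℝ} (h : Tendsto f (𝓝[<] x) (𝓝 L))
    (hV : V ∈ 𝓝 L) : ∀ᶠ y in 𝓝[<] x, f y ∈ V ∧ leftLim f y ∈ V ∧ rightLim f y ∈ V := by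
  obtain ⟨C, hC, hCc, hCV⟩ := exists_mem_nhds_isClosed_subset hV
  obtain ⟨d, hd, hsub⟩ := mem_nhdsLT_iff_exists_Ioo_subset.1 (h hC)
  filter_upwards [Ioo_mem_nhdsLT hd] with y hy
  exact ⟨hCV (hsub hy), hCV (leftLim_mem_of_forall_mem isOpen_Ioo hCc hsub hy),
    hCV (rightLim_mem_of_forall_mem isOpen_Ioo hCc hsub hy)⟩

lemma exists_Ioo_Icc_subset {I : Set ℝ} (hI : IsOpen I) (hx : x ∈ I) :
    ∃ c d, c < x ∧ x < d ∧ Icc c d ⊆ I := by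
  obtain ⟨ε, hε, h⟩ := Metric.nhds_basis_closedBall.mem_iff.1 (hI.mem_nhds hx)
  exact ⟨x - ε, x + ε, by linarith, by linarith, Real.closedBall_eq_Icc ▸ h⟩

lemma LocallyBoundedVariationOn.tendsto_rightLim {I : Set ℝ} (hI : IsOpen I)
    (hf : LocallyBoundedVariationOn f I) (hx : x ∈ I) :
    Tendsto f (𝓝[>] x) (𝓝 (rightLim f x)) := by
  obtain ⟨c, d, hc, hd, hcd⟩ := exists_Ioo_Icc_subset hI hx
  have hbv := hf c d (hcd ⟨le_rfl, by linarith⟩) (hcd ⟨by linarith, le_rfl⟩)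
  obtain ⟨l, hl⟩ := hbv.exists_tendsto_right x
  refine tendsto_rightLim_of_tendsto ⟨l, hl.mono_left ?_⟩
  refine nhdsWithin_le_of_mem (mem_of_superset (Ioo_mem_nhdsGT hd) fun y hy ↦ ?_)
  have : y ∈ Icc c d := ⟨by linarith [hy.1], hy.2.le⟩
  exact ⟨⟨hcd this, this⟩, hy.1⟩

lemma LocallyBoundedVariationOn.tendsto_leftLim {I : Set ℝ} (hI : IsOpen I)
    (hf : LocallyBoundedVariationOn f I) (hx : x ∈ I) :
    Tendsto f (𝓝[<] x) (𝓝 (leftLim f x)) := by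
  obtain ⟨c, d, hc, hd, hcd⟩ := exists_Ioo_Icc_subset hI hx
  have hbv := hf c d (hcd ⟨le_rfl, by linarith⟩) (hcd ⟨by linarith, le_rfl⟩)
  obtain ⟨l, hl⟩ := hbv.exists_tendsto_left x
  refine tendsto_leftLim_of_tendsto ⟨l, hl.mono_left ?_⟩
  refine nhdsWithin_le_of_mem (mem_of_superset (Ioo_mem_nhdsLT hc) fun y hy ↦ ?_)
  have : y ∈ Icc c d := ⟨hy.1.le, by linarith [hy.2]⟩
  exact ⟨⟨hcd this, this⟩, hy.2⟩

end OneSidedLimits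

section SignedMeasure

variable {ν : SignedMeasure ℝ}

lemma tendsto_measureReal_Ioo_right (μ : Measure ℝ) [IsFiniteMeasure μ] (s : ℝ) :
    Tendsto (fun d ↦ μ.real (Ioo s d)) (𝓝[>] s) (𝓝 0) := by
  have h := tendsto_measure_biInter_gt (μ := μ) (s := fun d ↦ Ioo s d) (a := s)
    (fun _ _ ↦ measurableSet_Ioo.nullMeasurableSet)
    (fun i j _ hij ↦ Ioo_subset_Ioo_right hij) ⟨s + 1, by simp, measure_ne_top _ _⟩
  have h0 : (⋂ r, ⋂ (_ : r > s), Ioo s r) = ∅ := by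
    refine eq_empty_of_forall_notMem fun x hx ↦ ?_
    simp only [mem_iInter] at hx
    have h1 := (hx (s + 1) (by linarith)).1
    exact lt_irrefl _ (hx x h1).2
  rw [h0, measure_empty] at h
  exact (ENNReal.tendsto_toReal ENNReal.zero_ne_top).comp h

lemma tendsto_measureReal_Ioo_left (μ : Measure ℝ) [IsFiniteMeasure μ] (s : ℝ) :
    Tendsto (fun d ↦ μ.real (Ioo d s)) (𝓝[<] s) (𝓝 0) := by
  have h := tendsto_measureReal_Ioo_right (μ.map Neg.neg) (-s)
  have hneg : Tendsto (Neg.neg : ℝ → ℝ) (𝓝[<] s) (𝓝[>] (-s)) := tendsto_neg_nhdsLT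
  refine (h.comp hneg).congr fun d ↦ ?_
  simp [measureReal_def, Measure.map_apply measurable_neg measurableSet_Ioo]

lemma signedMeasure_apply_eq_sub {E : Set ℝ} (hE : MeasurableSet E) :
    ν E = ν.toJordanDecomposition.posPart.real E - ν.toJordanDecomposition.negPart.real E := by
  conv_lhs => rw [← ν.toSignedMeasure_toJordanDecomposition]
  simp [JordanDecomposition.toSignedMeasure, Measure.toSignedMeasure_apply_measurable hE]

instance : IsFiniteMeasure ν.totalVariation := by
  unfold SignedMeasure.totalVariation; infer_instance

lemma totalVariation_real_apply (E : Set ℝ) :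
    ν.totalVariation.real E =
      ν.toJordanDecomposition.posPart.real E + ν.toJordanDecomposition.negPart.real E := by
  simp [SignedMeasure.totalVariation, measureReal_add_apply]

lemma abs_signedMeasure_le {E : Set ℝ} (hE : MeasurableSet E) :
    |ν E| ≤ ν.totalVariation.real E := by
  rw [signedMeasure_apply_eq_sub hE, totalVariation_real_apply, abs_le]
  constructor <;>
  linarith [measureReal_nonneg (μ := ν.toJordanDecomposition.posPart) (s := E),
    measureReal_nonneg (μ := ν.toJordanDecomposition.negPart) (s := E)]

lemma abs_sInt_le {h : ℝ → ℝ} {E : Set ℝ} {M : ℝ} (hM : ∀ x ∈ E, |h x| ≤ M) :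
    |sInt ν h E| ≤ M * ν.totalVariation.real E := by
  have h1 := norm_setIntegral_le_of_norm_le_const (f := h) (C := M)
    (measure_lt_top ν.toJordanDecomposition.posPart E) hM
  have h2 := norm_setIntegral_le_of_norm_le_const (f := h) (C := M)
    (measure_lt_top ν.toJordanDecomposition.negPart E) hM
  rw [totalVariation_real_apply, mul_add]
  exact (norm_sub_le _ _).trans (add_le_add h1 h2)

lemma sInt_singleton (h : ℝ → ℝ) (x : ℝ) : sInt ν h {x} = h x * ν {x} := by
  rw [sInt, integral_singleton, integral_singleton,
    signedMeasure_apply_eq_sub (measurableSet_singleton x)]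
  simp only [smul_eq_mul]
  ring

end SignedMeasure

section Represents

variable {ν : SignedMeasure ℝ} {f : ℝ → ℝ} {c d x y : ℝ}

lemma SMRepresents.apply_singleton (hν : SMRepresents ν f c d) (hcx : c < x) (hxd : x ≤ d)
    (hf : Tendsto f (𝓝[<] x) (𝓝 (leftLim f x))) : ν {x} = jump f x := by
  have hR : Tendsto (rightLim f) (𝓝[<] x) (𝓝 (leftLim f x)) := fun V hV ↦
    (eventually_lims_mem_nhdsLT hf hV).mono fun _ h ↦ h.2.2
  have h1 : Tendsto (fun y ↦ ν (Ioo y x)) (𝓝[<] x) (𝓝 (jump f x - ν {x})) := by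
    refine ((tendsto_const_nhds (x := rightLim f x)).sub hR |>.sub_const (ν {x})).congr' ?_
    filter_upwards [Ioo_mem_nhdsLT hcx] with y hy
    rw [← hν y ⟨hy.1.le, hy.2.le.trans hxd⟩ x ⟨hcx.le, hxd⟩ hy.2.le, ← Ioo_union_right hy.2,
      VectorMeasure.of_union (by simp) measurableSet_Ioo (measurableSet_singleton x)]
    ring
  have h2 : Tendsto (fun y ↦ ν (Ioo y x)) (𝓝[<] x) (𝓝 0) :=
    squeeze_zero_norm (fun y ↦ abs_signedMeasure_le measurableSet_Ioo)
      (tendsto_measureReal_Ioo_left ν.totalVariation x)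
  linarith [tendsto_nhds_unique h1 h2]

lemma SMRepresents.apply_Ioo (hν : SMRepresents ν f c d) (hcx : c ≤ x) (hxy : x < y) (hyd : y ≤ d)
    (hf : Tendsto f (𝓝[<] y) (𝓝 (leftLim f y))) :
    ν (Ioo x y) = leftLim f y - rightLim f x := by
  have h := hν x ⟨hcx, hxy.le.trans hyd⟩ y ⟨hcx.trans hxy.le, hyd⟩ hxy.le
  rw [← Ioo_union_right hxy, VectorMeasure.of_union (by simp) measurableSet_Ioo
    (measurableSet_singleton y), hν.apply_singleton (hcx.trans_lt hxy) hyd hf, jump] at h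
  linarith

lemma SMRepresents.apply_Ico (hν : SMRepresents ν f c d) (hcx : c < x) (hxy : x < y) (hyd : y ≤ d)
    (hfx : Tendsto f (𝓝[<] x) (𝓝 (leftLim f x)))
    (hfy : Tendsto f (𝓝[<] y) (𝓝 (leftLim f y))) :
    ν (Ico x y) = leftLim f y - leftLim f x := by
  rw [← Ioo_union_left hxy, VectorMeasure.of_union (by simp) measurableSet_Ioo
    (measurableSet_singleton x), hν.apply_Ioo hcx.le hxy hyd hfy,
    hν.apply_singleton hcx (hxy.le.trans hyd) hfx, jump]
  ring

/-- A signed measure generated by a function which is increasing near `[c,d]` integrates like a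
positive measure which charges every open interval. -/
lemma SMRepresents.exists_measure_of_strictMonoOn {c' d' : ℝ} (hν : SMRepresents ν f c d)
    (hc : c' < c) (hd : d < d') (hcd : c < d) (hf : StrictMonoOn f (Icc c' d')) :
    ∃ μ : Measure ℝ, IsFiniteMeasure μ ∧ (∀ x y, c ≤ x → x < y → y ≤ d → 0 < μ (Ioo x y)) ∧
      ∀ h : ℝ → ℝ, (∀ ρ : Measure ℝ, IsFiniteMeasure ρ → IntegrableOn h (Icc c d) ρ) →
        ∀ E ⊆ Ioc c d, MeasurableSet E → sInt ν h E = ∫ x in E, h x ∂μ := by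
  have hle : c' ≤ d' := by linarith
  set F : ℝ → ℝ := IccExtend hle ((Icc c' d').domRestrict f) with hF
  have hmono : Monotone F := (hf.monotoneOn.monotone).IccExtend hle
  have hFf : ∀ z ∈ Icc c' d', F z = f z := fun z hz ↦ by
    rw [hF, IccExtend_of_mem hle _ hz]; rfl
  have hlim : ∀ z ∈ Icc c d, rightLim F z = rightLim f z := fun z hz ↦ by
    symm
    refine rightLim_eq_of_tendsto ((hmono.tendsto_rightLim z).congr' ?_)
    filter_upwards [Ioo_mem_nhdsGT (show z < d' by linarith [hz.2])] with t ht
    exact hFf t ⟨by linarith [hz.1, ht.1], ht.2.le⟩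
  set m : Measure ℝ := hmono.stieltjesFunction.measure with hm
  have hIoc : ∀ x y, m (Ioc x y) = ENNReal.ofReal (rightLim F y - rightLim F x) := fun x y ↦ by
    rw [hm, StieltjesFunction.measure_Ioc, hmono.stieltjesFunction_eq, hmono.stieltjesFunction_eq]
  set P := ν.toJordanDecomposition.posPart
  set N := ν.toJordanDecomposition.negPart
  have hfin : IsFiniteMeasure (m.restrict (Ioc c d)) :=
    ⟨by rw [Measure.restrict_apply_univ, hIoc]; exact ENNReal.ofReal_lt_top⟩
  have key : P.restrict (Ioc c d) = N.restrict (Ioc c d) + m.restrict (Ioc c d) := by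
    refine Measure.ext_of_Ioc _ _ fun p q _ ↦ ?_
    rw [Measure.add_apply, Measure.restrict_apply measurableSet_Ioc,
      Measure.restrict_apply measurableSet_Ioc, Measure.restrict_apply measurableSet_Ioc,
      Ioc_inter_Ioc]
    rcases le_or_gt (p ⊔ c) (q ⊓ d) with hpq | hpq
    · have hx : p ⊔ c ∈ Icc c d := ⟨le_sup_right, hpq.trans inf_le_right⟩
      have hy : q ⊓ d ∈ Icc c d := ⟨le_sup_right.trans hpq, inf_le_right⟩
      have h := hν _ hx _ hy hpq
      rw [signedMeasure_apply_eq_sub measurableSet_Ioc] at h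
      rw [hIoc, hlim _ hx, hlim _ hy, ← ofReal_measureReal, ← ofReal_measureReal,
        ← ENNReal.ofReal_add measureReal_nonneg]
      · congr 1
        linarith
      · rw [← hlim _ hx, ← hlim _ hy]
        exact sub_nonneg.2 (hmono.rightLim hpq)
    · simp [Ioc_eq_empty_of_le hpq.le]
  refine ⟨m.restrict (Ioc c d), hfin, fun x y hx hxy hy ↦ ?_, fun h hint E hE hEm ↦ ?_⟩
  · obtain ⟨p, hxp, hpy⟩ := exists_between hxy
    obtain ⟨q, hpq, hqy⟩ := exists_between hpy
    obtain ⟨t, hpt, htq⟩ := exists_between hpq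
    rw [Measure.restrict_apply measurableSet_Ioo, inter_eq_left.2
      (Ioo_subset_Ioc_self.trans (Ioc_subset_Ioc hx hy))]
    have hsub : Ioc p q ⊆ Ioo x y := fun z hz ↦ ⟨hxp.trans hz.1, hz.2.trans_lt hqy⟩
    refine lt_of_lt_of_le ?_ (measure_mono hsub)
    rw [hIoc, ENNReal.ofReal_pos, sub_pos]
    have ht : t ∈ Icc c' d' := ⟨by linarith, by linarith⟩
    have hq : q ∈ Icc c' d' := ⟨by linarith, by linarith⟩
    calc rightLim F p ≤ F t := hmono.rightLim_le hpt
      _ = f t := hFf t ht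
      _ < f q := hf ht hq htq
      _ = F q := (hFf q hq).symm
      _ ≤ rightLim F q := hmono.le_rightLim le_rfl
  · have hr : ∀ ρ : Measure ℝ, ρ.restrict E = (ρ.restrict (Ioc c d)).restrict E := fun ρ ↦ by
      rw [Measure.restrict_restrict hEm, inter_eq_left.2 hE]
    have hi : ∀ ρ : Measure ℝ, IsFiniteMeasure ρ → IntegrableOn h E ρ := fun ρ hρ ↦
      (hint ρ hρ).mono_set (hE.trans Ioc_subset_Icc_self)
    rw [sInt, sub_eq_iff_eq_add, hr P, key, Measure.restrict_add, ← hr N,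
      integral_add_measure (hi N inferInstance) (hi _ hfin), add_comm]

end Represents

lemma LocallyBoundedVariationOn.integrableOn_Icc {I : Set ℝ} {h : ℝ → ℝ} {c d : ℝ}
    (hh : LocallyBoundedVariationOn h I) (hcd : Icc c d ⊆ I) (ρ : Measure ℝ)
    [IsFiniteMeasure ρ] : IntegrableOn h (Icc c d) ρ := by
  obtain ⟨p, q, hp, hq, rfl⟩ := hh.exists_monotoneOn_sub_monotoneOn
  exact ((hp.mono hcd).integrableOn_isCompact isCompact_Icc).sub
    ((hq.mono hcd).integrableOn_isCompact isCompact_Icc)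

section MeasureEq

variable {I : Set ℝ} {r s : ℝ} {f g h α : ℝ → ℝ}

lemma MeasureEqOn.jump_eq (hI : IsOpen I) (hf : LocallyBoundedVariationOn f I)
    (hg : LocallyBoundedVariationOn g I)
    (hm : MeasureEqOn I g (fun _ : Fin 1 ↦ h) (fun _ ↦ f)) (hs : s ∈ I) :
    jump g s = h s * jump f s := by
  obtain ⟨c, d, hc, hd, hcd⟩ := exists_Ioo_Icc_subset hI hs
  obtain ⟨νg, ν, hνg, hν, hE⟩ := hm c (hcd ⟨le_rfl, by linarith⟩) d
    (hcd ⟨by linarith, le_rfl⟩) (hc.trans hd)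
  have h1 := hE {s} (by simp [hc, hd.le]) (measurableSet_singleton s)
  rwa [Fin.sum_univ_one, sInt_singleton, hνg.apply_singleton hc hd.le (hg.tendsto_leftLim hI hs),
    (hν 0).apply_singleton hc hd.le (hf.tendsto_leftLim hI hs)] at h1

lemma abs_balanced_sub_le {p q G K : ℝ} (hr : r ∈ Icc (0 : ℝ) 1) (hp : |p - G| ≤ K)
    (hq : |q - G| ≤ K) : |r * p + (1 - r) * q - G| ≤ K := by
  have := (convex_Icc (G - K) (G + K)) (x := p) (by constructor <;> linarith [abs_le.1 hp])
    (y := q) (by constructor <;> linarith [abs_le.1 hq]) hr.1 (sub_nonneg.2 hr.2) (by ring)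
  simp only [smul_eq_mul, mem_Icc] at this
  exact abs_le.2 ⟨by linarith, by linarith⟩

lemma MeasureEqOn.abs_sub_rightLim_le (hI : IsOpen I) (hr : r ∈ Icc (0 : ℝ) 1)
    (hg : RBalanced r I g) (hm : MeasureEqOn I g (fun _ : Fin 1 ↦ h) (fun _ ↦ f))
    (hs : s ∈ I) : ∀ᶠ d in 𝓝[>] s, ∀ M, (∀ x ∈ Ioo s d, |h x| ≤ M) →
      ∀ y ∈ Ioo s d, |g y - rightLim g s| ≤ M / 2 := by
  obtain ⟨c, e, hc, he, hce⟩ := exists_Ioo_Icc_subset hI hs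
  obtain ⟨νg, ν, hνg, hν, hE⟩ := hm c (hce ⟨le_rfl, by linarith⟩) e
    (hce ⟨by linarith, le_rfl⟩) (hc.trans he)
  filter_upwards [Ioo_mem_nhdsGT he,
    (tendsto_measureReal_Ioo_right (ν 0).totalVariation s).eventually_le_const
      (show (0 : ℝ) < 1 / 2 by norm_num)] with d hd hTV M hM y hy
  have hM0 : 0 ≤ M := (abs_nonneg _).trans (hM y hy)
  have hyI : y ∈ I := hce ⟨by linarith [hy.1], by linarith [hy.2, hd.2]⟩
  have hbd : ∀ E, MeasurableSet E → E ⊆ Ioo s d → |νg E| ≤ M / 2 := fun E hEm hEs ↦ by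
    rw [hE E (hEs.trans fun z hz ↦ ⟨by linarith [hz.1], by linarith [hz.2, hd.2]⟩) hEm,
      Fin.sum_univ_one]
    have h1 := abs_sInt_le (ν := ν 0) fun x hx ↦ hM x (hEs hx)
    have h2 := (measureReal_mono (μ := (ν 0).totalVariation) hEs).trans hTV
    nlinarith
  have hye : y ≤ e := by linarith [hy.2, hd.2]
  rw [hg.2 y hyI]
  apply abs_balanced_sub_le hr
  · rw [← hνg.apply_Ioo hc.le hy.1 hye (hg.1.tendsto_leftLim hI hyI)]
    exact hbd _ measurableSet_Ioo (Ioo_subset_Ioo_right hy.2.le)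
  · rw [← hνg s ⟨hc.le, he.le⟩ y ⟨by linarith [hy.1], hye⟩ hy.1.le]
    exact hbd _ measurableSet_Ioc fun z hz ↦ ⟨hz.1, hz.2.trans_lt hy.2⟩

lemma MeasureEqOn.abs_sub_leftLim_le (hI : IsOpen I) (hr : r ∈ Icc (0 : ℝ) 1)
    (hg : RBalanced r I g) (hm : MeasureEqOn I g (fun _ : Fin 1 ↦ h) (fun _ ↦ f))
    (hs : s ∈ I) : ∀ᶠ d in 𝓝[<] s, ∀ M, (∀ x ∈ Ioo d s, |h x| ≤ M) →
      ∀ y ∈ Ioo d s, |g y - leftLim g s| ≤ M / 2 := by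
  obtain ⟨c, e, hc, he, hce⟩ := exists_Ioo_Icc_subset hI hs
  obtain ⟨νg, ν, hνg, hν, hE⟩ := hm c (hce ⟨le_rfl, by linarith⟩) e
    (hce ⟨by linarith, le_rfl⟩) (hc.trans he)
  filter_upwards [Ioo_mem_nhdsLT hc,
    (tendsto_measureReal_Ioo_left (ν 0).totalVariation s).eventually_le_const
      (show (0 : ℝ) < 1 / 2 by norm_num)] with d hd hTV M hM y hy
  have hM0 : 0 ≤ M := (abs_nonneg _).trans (hM y hy)
  have hyI : y ∈ I := hce ⟨by linarith [hy.1, hd.1], by linarith [hy.2]⟩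
  have hbd : ∀ E, MeasurableSet E → E ⊆ Ioo d s → |νg E| ≤ M / 2 := fun E hEm hEs ↦ by
    rw [hE E (hEs.trans fun z hz ↦ ⟨by linarith [hz.1, hd.1], by linarith [hz.2]⟩) hEm,
      Fin.sum_univ_one]
    have h1 := abs_sInt_le (ν := ν 0) fun x hx ↦ hM x (hEs hx)
    have h2 := (measureReal_mono (μ := (ν 0).totalVariation) hEs).trans hTV
    nlinarith
  have hcy : c < y := by linarith [hy.1, hd.1]
  have hls := hg.1.tendsto_leftLim hI hs
  rw [hg.2 y hyI]
  apply abs_balanced_sub_le hr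
  · rw [abs_sub_comm, ← hνg.apply_Ico hcy hy.2 he.le (hg.1.tendsto_leftLim hI hyI) hls]
    exact hbd _ measurableSet_Ico fun z hz ↦ ⟨hy.1.trans_le hz.1, hz.2⟩
  · rw [abs_sub_comm, ← hνg.apply_Ioo hcy.le hy.2 he.le hls]
    exact hbd _ measurableSet_Ioo (Ioo_subset_Ioo_left hy.1.le)

/-- If `dg = h dα` with `α` strictly increasing and `k h > 0` on `(x,y)`, then `k g` increases
across `(x,y)`. -/
lemma MeasureEqOn.mul_sub_pos (hI : IsOpen I) (hα : StrictMonoOn α I)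
    (hg : LocallyBoundedVariationOn g I) (hh : LocallyBoundedVariationOn h I)
    (hm : MeasureEqOn I g (fun _ : Fin 1 ↦ h) (fun _ ↦ α)) {x y k : ℝ} (hxy : x < y)
    (hI' : Icc x y ⊆ I) (hk : ∀ z ∈ Ioo x y, 0 < k * h z) :
    0 < k * (leftLim g y - rightLim g x) := by
  have hx : x ∈ I := hI' (left_mem_Icc.2 hxy.le)
  have hy : y ∈ I := hI' (right_mem_Icc.2 hxy.le)
  obtain ⟨c', _, hc', hc'', hc⟩ := exists_Ioo_Icc_subset hI hx
  obtain ⟨_, d', hd'', hd', hd⟩ := exists_Ioo_Icc_subset hI hy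
  have hsub : Icc c' d' ⊆ I := fun z hz ↦ by
    rcases le_or_gt z x with h1 | h1
    · exact hc ⟨hz.1, by linarith⟩
    rcases le_or_gt y z with h2 | h2
    · exact hd ⟨by linarith, hz.2⟩
    · exact hI' ⟨h1.le, h2.le⟩
  obtain ⟨νg, ν, hνg, hν, hE⟩ := hm x hx y hy hxy
  obtain ⟨μ, hμ, hpos, hint⟩ :=
    (hν 0).exists_measure_of_strictMonoOn hc' hd' hxy (hα.mono hsub)
  have hi : ∀ ρ : Measure ℝ, IsFiniteMeasure ρ → IntegrableOn h (Icc x y) ρ :=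
    fun ρ _ ↦ hh.integrableOn_Icc hI' ρ
  rw [← hνg.apply_Ioo le_rfl hxy le_rfl (hg.tendsto_leftLim hI hy),
    hE _ Ioo_subset_Ioc_self measurableSet_Ioo, Fin.sum_univ_one,
    hint h hi _ Ioo_subset_Ioc_self measurableSet_Ioo, ← integral_const_mul,
    setIntegral_pos_iff_support_of_nonneg_ae]
  · rw [inter_eq_right.2 fun z hz ↦ mem_support.2 (hk z hz).ne']
    exact hpos x y le_rfl hxy le_rfl
  · exact (ae_restrict_iff' measurableSet_Ioo).2 (ae_of_all _ fun z hz ↦ (hk z hz).le)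
  · exact ((hi μ hμ).mono_set Ioo_subset_Icc_self).const_mul k

end MeasureEq

section Solutions

variable {I : Set ℝ} {r s : ℝ} {α β u w : ℝ → ℝ}

lemma eq_zero_of_abs_le_half {J : Set ℝ} {M₀ : ℝ} (h₀ : ∀ x ∈ J, |u x| ≤ M₀ ∧ |w x| ≤ M₀)
    (hu : ∀ M, (∀ x ∈ J, |w x| ≤ M) → ∀ x ∈ J, |u x| ≤ M / 2)
    (hw : ∀ M, (∀ x ∈ J, |u x| ≤ M) → ∀ x ∈ J, |w x| ≤ M / 2) :
    ∀ x ∈ J, u x = 0 ∧ w x = 0 := by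
  have hn : ∀ n : ℕ, ∀ x ∈ J, |u x| ≤ M₀ * (1 / 2) ^ n ∧ |w x| ≤ M₀ * (1 / 2) ^ n := fun n ↦ by
    induction n with
    | zero => simpa using h₀
    | succ n ih =>
      intro x hx
      have h1 := hu _ (fun y hy ↦ (ih y hy).2) x hx
      have h2 := hw _ (fun y hy ↦ (ih y hy).1) x hx
      rw [pow_succ]
      constructor <;> linarith
  have hlim : Tendsto (fun n : ℕ ↦ M₀ * (1 / 2 : ℝ) ^ n) atTop (𝓝 0) := by
    simpa using (tendsto_pow_atTop_nhds_zero_of_lt_one (r := (1 / 2 : ℝ)) (by norm_num)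
      (by norm_num)).const_mul M₀
  exact fun x hx ↦
    ⟨abs_nonpos_iff.1 (ge_of_tendsto' hlim fun n ↦ (hn n x hx).1),
      abs_nonpos_iff.1 (ge_of_tendsto' hlim fun n ↦ (hn n x hx).2)⟩

lemma mul_pos_of_mul_pos_mul_pos {k p q : ℝ} (hp : 0 < k * p) (hq : 0 < k * q) : 0 < p * q := by
  by_contra! h
  nlinarith [mul_pos hp hq, mul_nonneg (sq_nonneg k) (neg_nonneg.2 h)]

lemma MonotoneOn.jump_nonneg (hI : IsOpen I) (hα : MonotoneOn α I) (hs : s ∈ I) :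
    0 ≤ jump α s := by
  have hbv := hα.locallyBoundedVariationOn
  have hn : I ∈ 𝓝 s := hI.mem_nhds hs
  have h1 : leftLim α s ≤ α s := le_of_tendsto (hbv.tendsto_leftLim hI hs) (by
    filter_upwards [self_mem_nhdsWithin, mem_nhdsWithin_of_mem_nhds hn] with y hy hyI
    exact hα hyI hs (le_of_lt hy))
  have h2 : α s ≤ rightLim α s := ge_of_tendsto (hbv.tendsto_rightLim hI hs) (by
    filter_upwards [self_mem_nhdsWithin, mem_nhdsWithin_of_mem_nhds hn] with y hy hyI
    exact hα hs hyI (le_of_lt hy))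
  exact sub_nonneg.2 (h1.trans h2)

lemma IsHomSol.eventually_eq_zero_right (hI : IsOpen I) (hr : r ∈ Icc (0 : ℝ) 1)
    (hsol : IsHomSol I r α β u w) (hs : s ∈ I) (hu : rightLim u s = 0)
    (hw : rightLim w s = 0) : ∀ᶠ y in 𝓝[>] s, u y = 0 ∧ w y = 0 := by
  obtain ⟨hub, hwb, hum, hwm⟩ := hsol
  have hu0 := hub.1.tendsto_rightLim hI hs
  have hw0 := hwb.1.tendsto_rightLim hI hs
  rw [hu] at hu0
  rw [hw] at hw0
  have hV : {t : ℝ | |t| ≤ 1} ∈ 𝓝 (0 : ℝ) := by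
    simpa [Metric.closedBall, Real.dist_eq] using
      Metric.closedBall_mem_nhds (0 : ℝ) one_pos
  obtain ⟨e, he, hbd⟩ := mem_nhdsGT_iff_exists_Ioo_subset.1 (inter_mem (hu0 hV) (hw0 hV))
  have he' : ∀ᶠ d in 𝓝[>] s, d ∈ Ioo s e := Ioo_mem_nhdsGT he
  obtain ⟨d, hd, hd1, hd2⟩ := (he'.and
    ((hum.abs_sub_rightLim_le hI hr hub hs).and
      (hwm.abs_sub_rightLim_le hI hr hwb hs))).exists
  rw [hu] at hd1
  rw [hw] at hd2
  simp only [sub_zero] at hd1 hd2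
  filter_upwards [Ioo_mem_nhdsGT hd.1] with y hy
  exact eq_zero_of_abs_le_half (fun x hx ↦ hbd ⟨hx.1, hx.2.trans hd.2⟩) hd1 hd2 y hy

lemma IsHomSol.eventually_eq_zero_left (hI : IsOpen I) (hr : r ∈ Icc (0 : ℝ) 1)
    (hsol : IsHomSol I r α β u w) (hs : s ∈ I) (hu : leftLim u s = 0)
    (hw : leftLim w s = 0) : ∀ᶠ y in 𝓝[<] s, u y = 0 ∧ w y = 0 := by
  obtain ⟨hub, hwb, hum, hwm⟩ := hsol
  have hu0 := hub.1.tendsto_leftLim hI hs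
  have hw0 := hwb.1.tendsto_leftLim hI hs
  rw [hu] at hu0
  rw [hw] at hw0
  have hV : {t : ℝ | |t| ≤ 1} ∈ 𝓝 (0 : ℝ) := by
    simpa [Metric.closedBall, Real.dist_eq] using
      Metric.closedBall_mem_nhds (0 : ℝ) one_pos
  obtain ⟨e, he, hbd⟩ := mem_nhdsLT_iff_exists_Ioo_subset.1 (inter_mem (hu0 hV) (hw0 hV))
  have he' : ∀ᶠ d in 𝓝[<] s, d ∈ Ioo e s := Ioo_mem_nhdsLT he
  obtain ⟨d, hd, hd1, hd2⟩ := (he'.and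
    ((hum.abs_sub_leftLim_le hI hr hub hs).and
      (hwm.abs_sub_leftLim_le hI hr hwb hs))).exists
  rw [hu] at hd1
  rw [hw] at hd2
  simp only [sub_zero] at hd1 hd2
  filter_upwards [Ioo_mem_nhdsLT hd.2] with y hy
  exact eq_zero_of_abs_le_half (fun x hx ↦ hbd ⟨hd.1.trans hx.1, hx.2⟩) hd1 hd2 y hy

lemma setOf_mul_pos_mem_nhds {k : ℝ} (hk : k ≠ 0) : {t : ℝ | 0 < k * t} ∈ 𝓝 k :=
  (isOpen_lt continuous_const (continuous_const.mul continuous_id)).mem_nhds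
    (mul_self_pos.2 hk)

lemma IsHomSol.eventually_mul_pos_right (hI : IsOpen I) (hα : StrictMonoOn α I)
    (hsol : IsHomSol I r α β u w) (hs : s ∈ I)
    (hne : ¬ (rightLim u s = 0 ∧ rightLim w s = 0)) :
    ∀ᶠ y in 𝓝[>] s, 0 < leftLim u y * rightLim u y := by
  obtain ⟨hub, hwb, hum, -⟩ := hsol
  by_cases hu : rightLim u s = 0
  · have hk : rightLim w s ≠ 0 := fun hw ↦ hne ⟨hu, hw⟩
    set k := rightLim w s
    have hev := eventually_lims_mem_nhdsGT (hwb.1.tendsto_rightLim hI hs)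
      (setOf_mul_pos_mem_nhds hk)
    obtain ⟨d, hd, hsub⟩ := mem_nhdsGT_iff_exists_Ioo_subset.1
      (inter_mem hev (mem_nhdsWithin_of_mem_nhds (hI.mem_nhds hs)))
    filter_upwards [Ioo_mem_nhdsGT hd] with y hy
    have hsI : Icc s y ⊆ I := fun z hz ↦ by
      rcases hz.1.eq_or_lt with rfl | h
      exacts [hs, (hsub ⟨h, hz.2.trans_lt hy.2⟩).2]
    have h1 := hum.mul_sub_pos hI hα hub.1 hwb.1 hy.1 hsI
      fun z hz ↦ (hsub ⟨hz.1, hz.2.trans hy.2⟩).1.1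
    have h2 := hum.jump_eq hI hα.monotoneOn.locallyBoundedVariationOn hub.1 (hsub hy).2
    have h3 := mul_nonneg (le_of_lt (hsub hy).1.1) (hα.monotoneOn.jump_nonneg hI (hsub hy).2)
    rw [mul_assoc, ← h2, jump] at h3
    rw [hu] at h1
    refine mul_pos_of_mul_pos_mul_pos (k := k) ?_ ?_ <;> linarith
  · filter_upwards [eventually_lims_mem_nhdsGT (hub.1.tendsto_rightLim hI hs)
      (setOf_mul_pos_mem_nhds hu)] with y hy
    exact mul_pos_of_mul_pos_mul_pos hy.2.1 hy.2.2

lemma IsHomSol.eventually_mul_pos_left (hI : IsOpen I) (hα : StrictMonoOn α I)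
    (hsol : IsHomSol I r α β u w) (hs : s ∈ I)
    (hne : ¬ (leftLim u s = 0 ∧ leftLim w s = 0)) :
    ∀ᶠ y in 𝓝[<] s, 0 < leftLim u y * rightLim u y := by
  obtain ⟨hub, hwb, hum, -⟩ := hsol
  by_cases hu : leftLim u s = 0
  · have hk : leftLim w s ≠ 0 := fun hw ↦ hne ⟨hu, hw⟩
    set k := leftLim w s
    have hev := eventually_lims_mem_nhdsLT (hwb.1.tendsto_leftLim hI hs)
      (setOf_mul_pos_mem_nhds hk)
    obtain ⟨d, hd, hsub⟩ := mem_nhdsLT_iff_exists_Ioo_subset.1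
      (inter_mem hev (mem_nhdsWithin_of_mem_nhds (hI.mem_nhds hs)))
    filter_upwards [Ioo_mem_nhdsLT hd] with y hy
    have hsI : Icc y s ⊆ I := fun z hz ↦ by
      rcases hz.2.eq_or_lt with rfl | h
      exacts [hs, (hsub ⟨hy.1.trans_le hz.1, h⟩).2]
    have h1 := hum.mul_sub_pos hI hα hub.1 hwb.1 hy.2 hsI
      fun z hz ↦ (hsub ⟨hy.1.trans hz.1, hz.2⟩).1.1
    have h2 := hum.jump_eq hI hα.monotoneOn.locallyBoundedVariationOn hub.1 (hsub hy).2
    have h3 := mul_nonneg (le_of_lt (hsub hy).1.1) (hα.monotoneOn.jump_nonneg hI (hsub hy).2)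
    rw [mul_assoc, ← h2, jump] at h3
    rw [hu] at h1
    refine mul_pos_of_mul_pos_mul_pos (k := -k) ?_ ?_ <;> linarith
  · filter_upwards [eventually_lims_mem_nhdsLT (hub.1.tendsto_leftLim hI hs)
      (setOf_mul_pos_mem_nhds hu)] with y hy
    exact mul_pos_of_mul_pos_mul_pos hy.2.1 hy.2.2

lemma IsHomSol.leftLim_eq_zero_iff (hI : IsOpen I) (hα : LocallyBoundedVariationOn α I)
    (hβ : LocallyBoundedVariationOn β I) (hsol : IsHomSol I r α β u w) (hs : s ∈ I)
    (hθ : theta α β (1 - r) s ≠ 0 ∧ theta α β r s ≠ 0) :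
    (leftLim u s = 0 ∧ leftLim w s = 0) ↔ (rightLim u s = 0 ∧ rightLim w s = 0) := by
  obtain ⟨hub, hwb, hum, hwm⟩ := hsol
  have h1 := hum.jump_eq hI hα hub.1 hs
  have h2 := hwm.jump_eq hI hβ hwb.1 hs
  rw [hwb.2 s hs, jump] at h1
  rw [hub.2 s hs, jump] at h2
  unfold theta at hθ
  refine ⟨fun ⟨hu, hw⟩ ↦ ?_, fun ⟨hu, hw⟩ ↦ ?_⟩ <;> rw [hu, hw] at h1 h2
  · have h3 : rightLim u s * (1 - (1 - r) ^ 2 * jump α s * jump β s) = 0 := by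
      linear_combination h1 + (1 - r) * jump α s * h2
    have h4 := (mul_eq_zero.1 h3).resolve_right hθ.1
    exact ⟨h4, by rw [h4] at h2; linarith⟩
  · have h3 : leftLim u s * (1 - r ^ 2 * jump α s * jump β s) = 0 := by
      linear_combination -h1 + r * jump α s * h2
    have h4 := (mul_eq_zero.1 h3).resolve_right hθ.2
    exact ⟨h4, by rw [h4] at h2; linarith⟩

end Solutions

lemma isOpen_EI (a b : EReal) : IsOpen (EI a b) :=
  (isOpen_Ioo (a := a) (b := b)).preimage continuous_coe_real_ereal

lemma isPreconnected_EI (a b : EReal) : IsPreconnected (EI a b) := by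
  refine OrdConnected.isPreconnected ⟨fun x hx y hy z hz ↦ ?_⟩
  exact ⟨hx.1.trans_le (EReal.coe_le_coe_iff.2 hz.1),
    (EReal.coe_le_coe_iff.2 hz.2).trans_lt hy.2⟩

/-- Theorem 4.5: for a nontrivial real-valued `r`-balanced solution `u` of
`-d(dy/dα) + y dβ = 0`, the set `Z_{(a,b)}(u)` consists of isolated points. -/
theorem statement6 (a b : EReal) (hab : a < b) (r : ℝ) (hr : r ∈ Icc (0 : ℝ) 1)
    (α β : ℝ → ℝ) (hα : StrictMonoOn α (EI a b))
    (hβ : LocallyBoundedVariationOn β (EI a b))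
    (hθ : ∀ x ∈ EI a b, theta α β (1 - r) x ≠ 0 ∧ theta α β r x ≠ 0)
    (u w : ℝ → ℝ) (hsol : IsHomSol (EI a b) r α β u w)
    (hnt : ¬ ∀ x ∈ EI a b, u x = 0) :
    ∀ s ∈ ZSet u (EI a b), ∃ ε > (0 : ℝ),
      ∀ x ∈ ZSet u (EI a b), x ∈ Ioo (s - ε) (s + ε) → x = s := by
  have hI := isOpen_EI a b
  have hαbv := hα.monotoneOn.locallyBoundedVariationOn
  have hiff := fun x hx ↦ hsol.leftLim_eq_zero_iff hI hαbv hβ hx (hθ x hx)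
  set T : Set ℝ := {x ∈ EI a b | rightLim u x = 0 ∧ rightLim w x = 0}
  set T' : Set ℝ := {x ∈ EI a b | ¬ (rightLim u x = 0 ∧ rightLim w x = 0)}
  have hT : IsOpen T := by
    rw [isOpen_iff_eventually]
    intro x hx
    have hev : ∀ᶠ y in 𝓝[≠] x, u y = 0 ∧ w y = 0 := by
      rw [← nhdsLT_sup_nhdsGT, eventually_sup]
      have hl := (hiff x hx.1).2 hx.2
      exact ⟨hsol.eventually_eq_zero_left hI hr hx.1 hl.1 hl.2,
        hsol.eventually_eq_zero_right hI hr hx.1 hx.2.1 hx.2.2⟩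
    have hev' := eventually_eventually_nhdsWithin.2 hev
    rw [eventually_nhdsWithin_iff] at hev'
    filter_upwards [hev', hI.mem_nhds hx.1] with y hy hyI
    rcases eq_or_ne y x with rfl | hne
    · exact hx
    have h1 : ∀ᶠ z in 𝓝[>] y, u z = 0 ∧ w z = 0 :=
      (hy hne).filter_mono (nhdsWithin_le_of_mem
        (mem_nhdsWithin_of_mem_nhds (isOpen_compl_singleton.mem_nhds hne)))
    exact ⟨hyI, rightLim_eq_of_tendsto (tendsto_const_nhds.congr' (h1.mono fun z hz ↦ hz.1.symm)),
      rightLim_eq_of_tendsto (tendsto_const_nhds.congr' (h1.mono fun z hz ↦ hz.2.symm))⟩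
  have hpos : ∀ x ∈ T', ∀ᶠ y in 𝓝[≠] x, 0 < leftLim u y * rightLim u y := fun x hx ↦ by
    rw [← nhdsLT_sup_nhdsGT, eventually_sup]
    exact ⟨hsol.eventually_mul_pos_left hI hα hx.1 fun h ↦ hx.2 ((hiff x hx.1).1 h),
      hsol.eventually_mul_pos_right hI hα hx.1 hx.2⟩
  have hT' : IsOpen T' := by
    rw [isOpen_iff_eventually]
    intro x hx
    filter_upwards [eventually_nhdsWithin_iff.1 (hpos x hx), hI.mem_nhds hx.1] with y hy hyI
    rcases eq_or_ne y x with rfl | hne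
    · exact hx
    · exact ⟨hyI, fun h ↦ by simpa [h.1] using hy hne⟩
  rcases isPreconnected_iff_subset_of_disjoint.1 (isPreconnected_EI a b) T T' hT hT'
    (fun x hx ↦ (em _).imp (fun h ↦ ⟨hx, h⟩) fun h ↦ ⟨hx, h⟩)
    (eq_empty_of_forall_notMem fun x hx ↦ hx.2.2.2 hx.2.1.2) with h | h
  · refine absurd (fun x hx ↦ ?_) hnt
    rw [hsol.1.2 x hx, (h hx).2.1, ((hiff x hx).2 (h hx).2).1]
    ring
  · intro s hs
    obtain ⟨ε, hε, hsub⟩ := Metric.eventually_nhds_iff_ball.1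
      (eventually_nhdsWithin_iff.1 (hpos s (h hs.1)))
    refine ⟨ε, hε, fun x hx hxs ↦ ?_⟩
    by_contra hne
    exact (hsub x (by rwa [Real.ball_eq_Ioo]) hne).not_ge hx.2
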